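/- Let ℓ > 1 be an integer and β a multi-index with |β| = ℓ. There exists a constant C > 0 such that for all functions f, g on T³ with f, g ∈ H^ℓ(T³) ∩ W^{1,∞}(T³), the commutator satisfies ‖[∂^β, f ∂]g‖_{L²} ≤ C( ‖∂f‖_{L^∞} ‖∂g‖_{H^{ℓ−1}} + ‖∂g‖_{L^∞} ‖∂f‖_{H^{ℓ−1}} ), where [∂^β, f∂]g := ∂^β(f ∂_a g) − f ∂_a ∂^β g (for each fixed a ∈ {1,2,3}). -/

import Mathlib

noncomputable section

open MeasureTheory Real Set

/-- Points of the flat torus `T³`, modelled as `ℝ³` (functions are taken ℤ³-periodic). -/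
abbrev Pt : Type := Fin 3 → ℝ

/-- The fundamental domain `[0,1)³` of the torus, of unit volume. -/
def cube : Set Pt := Set.univ.pi fun _ => Set.Ico (0:ℝ) 1

/-- ℤ³-periodicity: the property of descending to the torus `T³`. -/
def Periodic3 (f : Pt → ℝ) : Prop :=
  ∀ (x : Pt) (k : Fin 3 → ℤ), f (fun i => x i + (k i : ℝ)) = f x

/-- The partial derivative `∂_i f`. -/
def pd (i : Fin 3) (f : Pt → ℝ) : Pt → ℝ := fun x => fderiv ℝ f x (Pi.single i 1)

/-- Iterated partial derivatives along a list of directions. -/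
def pdIter : List (Fin 3) → (Pt → ℝ) → (Pt → ℝ)
  | [], f => f
  | i :: js, f => pd i (pdIter js f)

/-- The squared homogeneous Sobolev seminorm `‖∂^k f‖_{L²}²` on the torus. -/
def HdotSq (k : ℕ) (f : Pt → ℝ) : ℝ :=
  ∫ x in cube, ∑ js : Fin k → Fin 3, (pdIter (List.ofFn js) f x) ^ 2

/-- Squared homogeneous seminorm of a vector field. -/
def HdotSqV (k : ℕ) (v : Pt → Pt) : ℝ :=
  ∑ a : Fin 3, HdotSq k (fun x => v x a)

/-- The homogeneous Sobolev seminorm `‖f‖_{Ḣ^k}`. -/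
def Hdot (k : ℕ) (f : Pt → ℝ) : ℝ := Real.sqrt (HdotSq k f)

/-- The Sobolev norm `‖f‖_{H^s}`. -/
def HSob (s : ℕ) (f : Pt → ℝ) : ℝ :=
  Real.sqrt (∑ k ∈ Finset.range (s+1), HdotSq k f)

/-- The Sobolev norm `‖v‖_{H^s}` of a vector field. -/
def HSobV (s : ℕ) (v : Pt → Pt) : ℝ :=
  Real.sqrt (∑ k ∈ Finset.range (s+1), HdotSqV k v)

/-- The norm `‖∂f‖_{H^m}` of the full gradient of `f`. -/
def HSobGrad (m : ℕ) (f : Pt → ℝ) : ℝ :=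
  Real.sqrt (∑ k ∈ Finset.range (m+1), HdotSq (k+1) f)

/-- The mean of `f` over the torus (the fundamental cube has unit volume). -/
def mean (f : Pt → ℝ) : ℝ := ∫ x in cube, f x

/-- The (vector-valued) mean of a vector field. -/
def meanV (v : Pt → Pt) : Pt := fun a => ∫ x in cube, v x a

/-- The `L²` norm of `f` over the torus. -/
def L2norm (f : Pt → ℝ) : ℝ := Real.sqrt (∫ x in cube, (f x) ^ 2)

/-- The `L²` norm of a vector field over the torus. -/
def L2normV (v : Pt → Pt) : ℝ := Real.sqrt (∫ x in cube, ∑ a, (v x a) ^ 2)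

/-- The `L^∞` norm of `f`. -/
def LinfNorm (f : Pt → ℝ) : ℝ := ⨆ x : Pt, |f x|

/-- The `L^∞` norm `‖∂f‖_{L^∞}` of the gradient of `f`. -/
def LinfGrad (f : Pt → ℝ) : ℝ := ⨆ x : Pt, Real.sqrt (∑ i, (pd i f x) ^ 2)

/-- The `L^∞` norm `‖∂v‖_{L^∞}` of the gradient of a vector field. -/
def LinfGradV (v : Pt → Pt) : ℝ :=
  ⨆ x : Pt, Real.sqrt (∑ a, ∑ i, (pd i (fun y => v y a) x) ^ 2)

/-- The density `ρ = t^{-3α} exp L`. -/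
def rho (α t : ℝ) (L : Pt → ℝ) : Pt → ℝ := fun x => t ^ (-(3*α)) * Real.exp (L x)

/-- The mixed inner product `(∂^{ℓ-1} v, ∂^ℓ L)_{L²}`, contracting all matching
indices with the Euclidean metric (for `ℓ = 1` this is `(v, ∂L)_{L²}`). -/
def ipMixed (ℓ : ℕ) (v : Pt → Pt) (L : Pt → ℝ) : ℝ :=
  ∫ x in cube, ∑ js : Fin (ℓ-1) → Fin 3, ∑ a,
    pdIter (List.ofFn js) (fun y => v y a) x * pdIter (List.ofFn js) (pd a L) x

/-- The first-order energy `E₁[v,L](t)` with correction constant `c`. -/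
def E1 (K α c t : ℝ) (v : Pt → Pt) (L : Pt → ℝ) : ℝ :=
  (∑ a, (meanV v a) ^ 2) + HdotSqV 1 v + K * HdotSq 1 L + c * t ^ (α - 1) * ipMixed 1 v L

/-- The homogeneous energy `E_ℓ[v,L](t)` of order `ℓ > 1` with correction constant `c`. -/
def Ehigher (K α c t : ℝ) (ℓ : ℕ) (v : Pt → Pt) (L : Pt → ℝ) : ℝ :=
  HdotSqV ℓ v + K * HdotSq ℓ L + c * t ^ (α - 1) * ipMixed ℓ v L

/-- The total energy `ℰ_s[v,L] = Σ_{k=1}^s E_k[v,L]`. -/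
def Etot (K α c t : ℝ) (s : ℕ) (v : Pt → Pt) (L : Pt → ℝ) : ℝ :=
  E1 K α c t v L + ∑ k ∈ Finset.Icc 2 s, Ehigher K α c t k v L

/-- Smooth periodic solutions of the expansion-normalized Euler–Poisson system on
`[t₀,∞) × T³`:  `∂_t L = −t^{−α} v^i ∂_i L − t^{−α} ∂_i v^i`,
`∂_t v^i = −t^{−α} K δ^{ij} ∂_j L − t^{−α} v^j ∂_j v^i − α t^{−1} v^i + t^{−α} δ^{ij} ∂_j φ`,
`t^{−2α} Δφ = −(ρ − ρ̄)` with `∫ φ = 0`, where `ρ = t^{−3α} exp L`. -/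
structure IsEPSolution (α K t₀ : ℝ) (L : ℝ → Pt → ℝ) (v : ℝ → Pt → Pt)
    (φ : ℝ → Pt → ℝ) : Prop where
  smooth_L : ∀ t ∈ Ici t₀, ContDiff ℝ (⊤ : ℕ∞) (L t)
  smooth_v : ∀ t ∈ Ici t₀, ∀ a, ContDiff ℝ (⊤ : ℕ∞) (fun x => v t x a)
  smooth_φ : ∀ t ∈ Ici t₀, ContDiff ℝ (⊤ : ℕ∞) (φ t)
  periodic_L : ∀ t ∈ Ici t₀, Periodic3 (L t)
  periodic_v : ∀ t ∈ Ici t₀, ∀ a, Periodic3 (fun x => v t x a)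
  periodic_φ : ∀ t ∈ Ici t₀, Periodic3 (φ t)
  eq_L : ∀ t ∈ Ici t₀, ∀ x, HasDerivWithinAt (fun τ => L τ x)
      (-(t ^ (-α)) * (∑ i, v t x i * pd i (L t) x)
        - t ^ (-α) * (∑ i, pd i (fun y => v t y i) x)) (Ici t₀) t
  eq_v : ∀ t ∈ Ici t₀, ∀ x, ∀ i, HasDerivWithinAt (fun τ => v τ x i)
      (-(t ^ (-α)) * K * pd i (L t) x
        - t ^ (-α) * (∑ j, v t x j * pd j (fun y => v t y i) x)
        - α * t⁻¹ * v t x i + t ^ (-α) * pd i (φ t) x) (Ici t₀) t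
  eq_φ : ∀ t ∈ Ici t₀, ∀ x,
      t ^ (-(2*α)) * (∑ i, pd i (pd i (φ t)) x)
        = -(rho α t (L t) x - mean (rho α t (L t)))
  mean_φ : ∀ t ∈ Ici t₀, mean (φ t) = 0

theorem le_pow_mul_add_of_sq_le_mul {m : ℕ} {K : ℝ} (hK : 1 ≤ K) {c : ℕ → ℝ}
    (hc : ∀ j, 0 ≤ c j) (h : ∀ j, j + 2 ≤ m → c (j + 1) ^ 2 ≤ K ^ 2 * (c j * c (j + 2)))
    {j : ℕ} (hj : j ≤ m) : c j ≤ K ^ (m * m) * (c 0 + c m) := by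
  have hK0 : 0 < K := by linarith
  let d : ℕ → ℝ := fun j => c j / K ^ (j * (m - j))
  have hd0 : ∀ j, 0 ≤ d j := fun j => div_nonneg (hc j) (by positivity)
  have hd : ∀ j, j + 2 ≤ m → d (j + 1) ^ 2 ≤ d j * d (j + 2) := by
    intro k hk
    obtain ⟨n, rfl⟩ := Nat.exists_eq_add_of_le hk
    have e1 : k + 2 + n - (k + 1) = n + 1 := by omega
    have e2 : k + 2 + n - k = n + 2 := by omega
    have e3 : k + 2 + n - (k + 2) = n := by omega
    simp only [d, e1, e2, e3]
    rw [div_pow, div_mul_div_comm, ← pow_add, div_le_div_iff₀ (by positivity) (by positivity)]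
    have e4 : (K ^ ((k + 1) * (n + 1))) ^ 2 = K ^ 2 * K ^ (k * (n + 2) + (k + 2) * n) := by
      rw [← pow_mul, ← pow_add]; congr 1; ring
    rw [e4]
    have := mul_le_mul_of_nonneg_right (h k hk)
      (by positivity : 0 ≤ K ^ (k * (n + 2) + (k + 2) * n))
    nlinarith
  have key : ∀ j ≤ m, d j ≤ d 0 + d m := by
    obtain ⟨i, hi, hmax⟩ := (Finset.range (m + 1)).exists_max_image d ⟨0, by simp⟩
    have hex : ∃ i, i ≤ m ∧ ∀ j ≤ m, d j ≤ d i :=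
      ⟨i, by simpa [Nat.lt_succ_iff] using hi, fun j hj => hmax j (by simpa [Nat.lt_succ_iff])⟩
    classical
    obtain ⟨him, hi⟩ := Nat.find_spec hex
    have hlt := fun k (hk : k < Nat.find hex) => Nat.find_min hex hk
    generalize Nat.find hex = i at him hi hlt
    rcases Nat.eq_zero_or_pos i with rfl | hpos
    · intro j hj
      linarith [hi j hj, hd0 m]
    rcases him.eq_or_lt with rfl | him'
    · intro j hj
      linarith [hi j hj, hd0 0]
    exfalso
    obtain ⟨k, rfl⟩ : ∃ k, i = k + 1 := ⟨i - 1, by omega⟩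
    have h1 : d k < d (k + 1) := by
      by_contra! hle
      exact hlt k (by omega) ⟨by omega, fun j hj => (hi j hj).trans hle⟩
    have h2 := hi (k + 2) (by omega)
    have h3 := hd k (by omega)
    nlinarith [hd0 k, hd0 (k + 1), hd0 (k + 2)]
  have hcd : d j ≤ c 0 + c m := by simpa [d] using key j hj
  have hcj : c j = K ^ (j * (m - j)) * d j := by
    simp only [d]; field_simp
  rw [hcj]
  have hpow : K ^ (j * (m - j)) ≤ K ^ (m * m) :=
    pow_le_pow_right₀ hK (Nat.mul_le_mul hj (Nat.sub_le _ _))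
  exact mul_le_mul hpow hcd (hd0 j) (by positivity)

theorem hasDerivAt_abs_rpow_mul_self {q : ℝ} (hq : 0 < q) (x : ℝ) :
    HasDerivAt (fun x : ℝ => |x| ^ q * x) ((q + 1) * |x| ^ q) x := by
  rcases eq_or_ne x 0 with rfl | hx
  · rw [hasDerivAt_iff_tendsto_slope]
    have hcont : Filter.Tendsto (fun x : ℝ => |x| ^ q) (nhds 0) (nhds 0) := by
      have : Continuous fun x : ℝ => |x| ^ q :=
        continuous_abs.rpow_const fun _ => Or.inr hq.le
      simpa [Real.zero_rpow hq.ne'] using this.tendsto 0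
    have h0 : (q + 1) * |(0 : ℝ)| ^ q = 0 := by simp [Real.zero_rpow hq.ne']
    rw [h0]
    refine (hcont.mono_left nhdsWithin_le_nhds).congr' ?_
    filter_upwards [self_mem_nhdsWithin] with y hy
    have hy : y ≠ 0 := hy
    simp [slope_def_field, hy]
  · have habs : |x| ≠ 0 := abs_ne_zero.2 hx
    have h := ((hasDerivAt_abs hx).rpow_const (p := q) (Or.inl habs)).mul (hasDerivAt_id x)
    refine h.congr_deriv ?_
    have hs : (SignType.sign x : ℝ) * x = |x| := sign_mul_self x
    have hp : |x| ^ (q - 1) * |x| = |x| ^ q := by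
      rw [← Real.rpow_add_one habs]; congr 1; ring
    simp only [id]
    calc _ = q * (|x| ^ (q - 1) * ((SignType.sign x : ℝ) * x)) + |x| ^ q := by ring
      _ = _ := by rw [hs, hp]; ring

/-- Smooth functions on the torus. -/
structure SmoothPeriodic (f : Pt → ℝ) : Prop where
  contDiff : ContDiff ℝ (⊤ : ℕ∞) f
  periodic : Periodic3 f

theorem pd_add {f g : Pt → ℝ} (hf : Differentiable ℝ f) (hg : Differentiable ℝ g) (i : Fin 3) :
    pd i (fun x => f x + g x) = fun x => pd i f x + pd i g x := by
  funext x
  simp [pd, fderiv_fun_add (hf x) (hg x)]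

theorem pd_mul {f g : Pt → ℝ} (hf : Differentiable ℝ f) (hg : Differentiable ℝ g) (i : Fin 3) :
    pd i (fun x => f x * g x) = fun x => pd i f x * g x + f x * pd i g x := by
  funext x
  simp [pd, fderiv_fun_mul (hf x) (hg x)]
  ring

theorem Periodic3.pd {f : Pt → ℝ} (hf : Periodic3 f) (i : Fin 3) : Periodic3 (pd i f) := by
  intro x k
  have h : (fun y : Pt => f (y + fun j => (k j : ℝ))) = f := funext fun y => hf y k
  have h2 := fderiv_comp_add_right (𝕜 := ℝ) (f := f) (x := x) (fun j => (k j : ℝ))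
  rw [h] at h2
  change fderiv ℝ f (x + fun j => (k j : ℝ)) _ = _
  rw [← h2]
  rfl

theorem contDiff_pd {f : Pt → ℝ} (hf : ContDiff ℝ (⊤ : ℕ∞) f) (i : Fin 3) :
    ContDiff ℝ (⊤ : ℕ∞) (pd i f) :=
  (hf.fderiv_right (m := (⊤ : ℕ∞)) (by simp)).clm_apply contDiff_const

namespace SmoothPeriodic

variable {f g : Pt → ℝ}

theorem differentiable (hf : SmoothPeriodic f) : Differentiable ℝ f :=
  hf.contDiff.differentiable (by simp)

theorem continuous (hf : SmoothPeriodic f) : Continuous f := hf.contDiff.continuous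

theorem pd (hf : SmoothPeriodic f) (i : Fin 3) : SmoothPeriodic (pd i f) :=
  ⟨contDiff_pd hf.contDiff i, hf.periodic.pd i⟩

theorem pdIter (hf : SmoothPeriodic f) (L : List (Fin 3)) : SmoothPeriodic (pdIter L f) := by
  induction L with
  | nil => exact hf
  | cons i L ih => exact ih.pd i

theorem add (hf : SmoothPeriodic f) (hg : SmoothPeriodic g) :
    SmoothPeriodic fun x => f x + g x :=
  ⟨hf.contDiff.add hg.contDiff, fun x k => by
    simp only [hf.periodic x k, hg.periodic x k]⟩

theorem mul (hf : SmoothPeriodic f) (hg : SmoothPeriodic g) :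
    SmoothPeriodic fun x => f x * g x :=
  ⟨hf.contDiff.mul hg.contDiff, fun x k => by
    simp only [hf.periodic x k, hg.periodic x k]⟩

theorem pdIter_add (hf : SmoothPeriodic f) (hg : SmoothPeriodic g) (L : List (Fin 3)) :
    _root_.pdIter L (fun x => f x + g x) = fun x => _root_.pdIter L f x + _root_.pdIter L g x := by
  induction L with
  | nil => rfl
  | cons i L ih =>
    simp only [_root_.pdIter, ih]
    exact pd_add (hf.pdIter L).differentiable (hg.pdIter L).differentiable i

theorem exists_bound (hf : SmoothPeriodic f) : ∃ C, ∀ x, |f x| ≤ C := by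
  obtain ⟨C, hC⟩ := (isCompact_Icc (a := (0 : Pt)) (b := 1)).exists_bound_of_continuousOn
    hf.continuous.continuousOn
  refine ⟨C, fun x => ?_⟩
  have h := hf.periodic x fun i => -⌊x i⌋
  rw [← h]
  refine hC _ ⟨fun i => ?_, fun i => ?_⟩
  · simpa using Int.floor_le (x i)
  · have := (Int.lt_floor_add_one (x i)).le
    simp only [Int.cast_neg, Pi.one_apply]
    linarith

end SmoothPeriodic

theorem pdIter_append_singleton (L : List (Fin 3)) (i : Fin 3) (f : Pt → ℝ) :
    pdIter (L ++ [i]) f = pdIter L (pd i f) := by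
  induction L with
  | nil => rfl
  | cons j L ih => simp [pdIter, ih]

theorem pd_comm {f : Pt → ℝ} (hf : ContDiff ℝ (⊤ : ℕ∞) f) (i j : Fin 3) :
    pd i (pd j f) = pd j (pd i f) := by
  have hd : Differentiable ℝ (fderiv ℝ f) :=
    (hf.fderiv_right (m := (⊤ : ℕ∞)) (by simp)).differentiable (by simp)
  have key : ∀ i j : Fin 3, ∀ x, pd i (pd j f) x
      = fderiv ℝ (fderiv ℝ f) x (Pi.single i 1) (Pi.single j 1) := by
    intro i j x
    change fderiv ℝ (fun y => fderiv ℝ f y (Pi.single j 1)) x (Pi.single i 1) = _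
    rw [fderiv_clm_apply (hd x) (differentiableAt_const _)]
    simp
  funext x
  rw [key, key]
  exact (hf.contDiffAt.isSymmSndFDerivAt (by
    rw [minSmoothness_of_isRCLikeNormedField]
    exact WithTop.coe_le_coe.2 le_top)) _ _

theorem pd_pdIter {f : Pt → ℝ} (hf : SmoothPeriodic f) (a : Fin 3) (L : List (Fin 3)) :
    pd a (pdIter L f) = pdIter L (pd a f) := by
  induction L with
  | nil => rfl
  | cons i L ih =>
    simp only [pdIter]
    rw [pd_comm (hf.pdIter L).contDiff, ih]

theorem cube_ae_eq : (cube : Set Pt) =ᵐ[volume] Icc (0 : Pt) 1 :=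
  Measure.univ_pi_Ico_ae_eq_Icc (f := fun _ : Fin 3 => (0 : ℝ)) (g := fun _ => 1)

instance : IsFiniteMeasure (volume.restrict cube) := by
  refine ⟨?_⟩
  rw [Measure.restrict_apply_univ, measure_congr cube_ae_eq]
  exact isCompact_Icc.measure_lt_top

theorem Continuous.integrable_cube {F : Pt → ℝ} (hF : Continuous F) :
    Integrable F (volume.restrict cube) := by
  have : IntegrableOn F (Icc 0 1) volume := hF.continuousOn.integrableOn_compact isCompact_Icc
  exact this.congr_set_ae cube_ae_eq

/-- The integral over the torus of a derivative vanishes. -/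
theorem integral_cube_pd_eq_zero {F : Pt → ℝ} (hF : ContDiff ℝ 1 F) (hper : Periodic3 F)
    (i : Fin 3) : ∫ x in cube, pd i F x = 0 := by
  have hcont : Continuous (pd i F) :=
    (hF.continuous_fderiv (by simp)).clm_apply continuous_const
  rw [setIntegral_congr_set cube_ae_eq]
  have hsum : ∀ x, ∑ k : Fin 3,
      (if k = i then fderiv ℝ F x else 0) (Pi.single k 1) = pd i F x := by
    intro x
    rw [Finset.sum_eq_single i (fun k _ hk => by simp [hk]) (by simp)]
    simp [pd]
  have h := integral_divergence_of_hasFDerivAt_off_countable' (n := 2) (E := ℝ) (0 : Pt) 1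
    (fun _ => zero_le_one) (fun k => if k = i then F else 0)
    (fun k x => if k = i then fderiv ℝ F x else 0) ∅ countable_empty
    (fun k => by
      split_ifs
      · exact hF.continuous.continuousOn
      · exact continuousOn_const)
    (fun x _ k => by
      split_ifs
      · exact (hF.differentiable (by simp) x).hasFDerivAt
      · exact hasFDerivAt_const _ _)
    (by
      simp only [hsum]
      exact hcont.continuousOn.integrableOn_compact isCompact_Icc)
  simp only [hsum] at h
  rw [h]
  refine Finset.sum_eq_zero fun k _ => ?_
  split_ifs with hk
  · rw [sub_eq_zero]
    congr 1
    funext x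
    have := hper (k.insertNth (0 : ℝ) x) (Pi.single k 1)
    change _ = F (k.insertNth (0 : ℝ) x)
    rw [← this]
    congr 1
    funext l
    refine Fin.succAboveCases k ?_ (fun r => ?_) l
    · simp
    · simp [Fin.succAbove_ne]
  · simp

theorem contDiff_abs_rpow_mul_self {q : ℝ} (hq : 0 < q) :
    ContDiff ℝ 1 fun x : ℝ => |x| ^ q * x := by
  rw [contDiff_one_iff_deriv]
  refine ⟨fun x => (hasDerivAt_abs_rpow_mul_self hq x).differentiableAt, ?_⟩
  have h : deriv (fun x : ℝ => |x| ^ q * x) = fun x => (q + 1) * |x| ^ q :=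
    funext fun x => (hasDerivAt_abs_rpow_mul_self hq x).deriv
  rw [h]
  exact continuous_const.mul (continuous_abs.rpow_const fun _ => Or.inr hq.le)

theorem integral_abs_rpow_pd_eq {v : Pt → ℝ} (hv : SmoothPeriodic v) (i : Fin 3) {p : ℝ}
    (hp : 2 < p) :
    ∫ x in cube, |pd i v x| ^ p
      = -((p - 1) * ∫ x in cube, |pd i v x| ^ (p - 2) * (v x * pd i (pd i v) x)) := by
  have hq : 0 < p - 2 := by linarith
  have hw := hv.pd i
  have hψ := (contDiff_abs_rpow_mul_self hq).comp (hw.contDiff.of_le (by simp))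
  have hF := (hv.contDiff.of_le (m := 1) (by simp)).mul hψ
  have hpd : ∀ x, pd i (fun x => v x * (|pd i v x| ^ (p - 2) * pd i v x)) x
      = |pd i v x| ^ p + (p - 1) * (|pd i v x| ^ (p - 2) * (v x * pd i (pd i v) x)) := by
    intro x
    have h1 : HasFDerivAt (fun x => |pd i v x| ^ (p - 2) * pd i v x)
        (((p - 2 + 1) * |pd i v x| ^ (p - 2)) • fderiv ℝ (pd i v) x) x :=
      (hasDerivAt_abs_rpow_mul_self hq (pd i v x)).comp_hasFDerivAt x
        (hw.differentiable x).hasFDerivAt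
    have h2 := (hv.differentiable x).hasFDerivAt.mul h1
    have habs : |pd i v x| ^ p = |pd i v x| ^ (p - 2) * (pd i v x * pd i v x) := by
      rw [← abs_mul_abs_self (pd i v x), ← pow_two, ← Real.rpow_natCast,
        ← Real.rpow_add_of_nonneg (abs_nonneg _) hq.le (by simp)]
      congr 1
      push_cast
      ring
    rw [habs]
    change fderiv ℝ _ x _ = _
    erw [h2.fderiv]
    simp only [add_apply, smul_apply, smul_eq_mul]
    change v x * ((p - 2 + 1) * |pd i v x| ^ (p - 2) * pd i (pd i v) x)
      + |pd i v x| ^ (p - 2) * pd i v x * pd i v x = _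
    ring
  have hper : Periodic3 fun x => v x * (|pd i v x| ^ (p - 2) * pd i v x) := fun x k => by
    simp only [hv.periodic x k, hw.periodic x k]
  have h := integral_cube_pd_eq_zero hF hper i
  have hc1 : Continuous fun x => |pd i v x| ^ p :=
    hw.continuous.abs.rpow_const fun _ => Or.inr (by linarith)
  have hc2 : Continuous fun x => |pd i v x| ^ (p - 2) * (v x * pd i (pd i v) x) :=
    (hw.continuous.abs.rpow_const fun _ => Or.inr hq.le).mul
      (hv.continuous.mul (hw.pd i).continuous)
  have h' : ∫ x in cube, (|pd i v x| ^ p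
      + (p - 1) * (|pd i v x| ^ (p - 2) * (v x * pd i (pd i v) x))) = 0 := by
    rw [← h]
    exact integral_congr_ae (Filter.Eventually.of_forall fun x => (hpd x).symm)
  rw [integral_add hc1.integrable_cube (hc2.integrable_cube.const_mul _),
    integral_const_mul] at h'
  linarith

theorem eLpNorm_mul_le_of_holderTriple {f g : Pt → ℝ} {μ : Measure Pt} (hf : Continuous f)
    (hg : Continuous g) (p q r : ENNReal) [ENNReal.HolderTriple p q r] :
    eLpNorm (fun x => f x * g x) r μ ≤ eLpNorm f p μ * eLpNorm g q μ :=
  eLpNorm_smul_le_mul_eLpNorm (φ := f) (f := g) hg.aestronglyMeasurable hf.aestronglyMeasurable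

theorem SmoothPeriodic.eLpNorm_ne_top {f : Pt → ℝ} (hf : SmoothPeriodic f) (p : ENNReal) :
    eLpNorm f p (volume.restrict cube) ≠ ⊤ := by
  obtain ⟨C, hC⟩ := hf.exists_bound
  exact (MemLp.of_bound hf.continuous.aestronglyMeasurable C
    (Filter.Eventually.of_forall hC)).eLpNorm_ne_top

/-- One step of the Gagliardo-Nirenberg interpolation. -/
theorem eLpNorm_pd_sq_le {v : Pt → ℝ} (hv : SmoothPeriodic v) (i : Fin 3) {p : ℝ}
    (hp : 2 < p) (q r : ENNReal) [ENNReal.HolderTriple q r (ENNReal.ofReal (p / 2))] :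
    eLpNorm (pd i v) (ENNReal.ofReal p) (volume.restrict cube) ^ 2
      ≤ ENNReal.ofReal (p - 1) * (eLpNorm v q (volume.restrict cube)
        * eLpNorm (pd i (pd i v)) r (volume.restrict cube)) := by
  have hq : 0 < p - 2 := by linarith
  have hp0 : 0 < p := by linarith
  have hw := hv.pd i
  set μ := volume.restrict cube with hμ
  set N := eLpNorm (pd i v) (ENNReal.ofReal p) μ with hN
  have hNtop : N ≠ ⊤ := hw.eLpNorm_ne_top _
  have hcq : Continuous fun x => |pd i v x| ^ (p - 2) :=
    hw.continuous.abs.rpow_const fun _ => Or.inr hq.le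
  have hvz : Continuous fun x => v x * pd i (pd i v) x :=
    hv.continuous.mul (hw.pd i).continuous
  have hint : N ^ p ≤ ENNReal.ofReal (p - 1)
      * eLpNorm (fun x => |pd i v x| ^ (p - 2) * (v x * pd i (pd i v) x)) 1 μ := by
    have h1 := eLpNorm_norm_rpow (p := 1) (μ := μ) (pd i v) hp0
    rw [one_mul] at h1
    rw [hN, ← h1, eLpNorm_one_eq_lintegral_enorm, eLpNorm_one_eq_lintegral_enorm]
    have hc1 : Continuous fun x => |pd i v x| ^ p :=
      hw.continuous.abs.rpow_const fun _ => Or.inr hp0.le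
    have h2 : ∫⁻ x, ‖‖pd i v x‖ ^ p‖ₑ ∂μ = ENNReal.ofReal (∫ x, |pd i v x| ^ p ∂μ) := by
      rw [ofReal_integral_eq_lintegral_ofReal hc1.integrable_cube
        (Filter.Eventually.of_forall fun x => by positivity)]
      refine lintegral_congr fun x => ?_
      rw [Real.norm_eq_abs, Real.enorm_of_nonneg (by positivity)]
    rw [h2, integral_abs_rpow_pd_eq hv i hp, ← mul_neg,
      ENNReal.ofReal_mul (by linarith)]
    gcongr
    calc _ ≤ ‖∫ x, |pd i v x| ^ (p - 2) * (v x * pd i (pd i v) x) ∂μ‖ₑ := by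
          rw [← ofReal_norm]
          exact ENNReal.ofReal_le_ofReal (neg_le_abs _)
      _ ≤ _ := enorm_integral_le_lintegral_enorm _
  have hT : ENNReal.HolderTriple (ENNReal.ofReal (p / (p - 2))) (ENNReal.ofReal (p / 2)) 1 := by
    constructor
    rw [← ENNReal.ofReal_inv_of_pos (by positivity), ← ENNReal.ofReal_inv_of_pos (by positivity),
      ← ENNReal.ofReal_add (by positivity) (by positivity)]
    rw [inv_one, ← ENNReal.ofReal_one]
    congr 1
    field_simp
    ring
  have hH := eLpNorm_mul_le_of_holderTriple (μ := μ) hcq hvz (ENNReal.ofReal (p / (p - 2)))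
    (ENNReal.ofReal (p / 2)) 1
  have hH2 := eLpNorm_mul_le_of_holderTriple (μ := μ) hv.continuous (hw.pd i).continuous q r
    (ENNReal.ofReal (p / 2))
  have hpow : eLpNorm (fun x => |pd i v x| ^ (p - 2)) (ENNReal.ofReal (p / (p - 2))) μ
      = N ^ (p - 2) := by
    have h1 := eLpNorm_norm_rpow (p := ENNReal.ofReal (p / (p - 2))) (μ := μ) (pd i v) hq
    rw [← ENNReal.ofReal_mul (by positivity), div_mul_cancel₀ _ hq.ne'] at h1
    exact h1
  rcases eq_or_ne N 0 with h0 | h0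
  · simp [h0]
  have hsplit : N ^ p = N ^ (p - 2) * N ^ 2 := by
    rw [← ENNReal.rpow_natCast, ← ENNReal.rpow_add _ _ h0 hNtop]
    congr 1
    push_cast
    ring
  have hfin : N ^ (p - 2) * N ^ 2 ≤ N ^ (p - 2) * (ENNReal.ofReal (p - 1)
      * (eLpNorm v q μ * eLpNorm (pd i (pd i v)) r μ)) := by
    rw [← hsplit]
    refine hint.trans ?_
    rw [mul_left_comm]
    gcongr
    refine hH.trans ?_
    rw [hpow]
    gcongr
  exact (ENNReal.mul_le_mul_iff_right (by simp [h0, hNtop])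
    (ENNReal.rpow_ne_top_of_nonneg hq.le hNtop)).1 hfin

/-- The exponent `2m/j` of the interpolation between `L^∞` (for `j = 0`) and `L²` (for `j = m`). -/
def interpExponent (m j : ℕ) : ENNReal := ((j : ENNReal) / (2 * m : ℕ))⁻¹

/-- The maximum over all words of length `j` of the `L^{2m/j}` norms of derivatives of `u`. -/
def derivNorm (m j : ℕ) (u : Pt → ℝ) : ENNReal :=
  ⨆ w : Fin j → Fin 3,
    eLpNorm (pdIter (List.ofFn w) u) (interpExponent m j) (volume.restrict cube)

theorem interpExponent_inv (m j : ℕ) :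
    (interpExponent m j)⁻¹ = (j : ENNReal) / (2 * m : ℕ) := inv_inv _

theorem interpExponent_eq_ofReal {m j : ℕ} (hm : 0 < m) (hj : 0 < j) :
    interpExponent m j = ENNReal.ofReal (2 * m / j) := by
  have hm' : (0 : ℝ) < m := by exact_mod_cast hm
  have hj' : (0 : ℝ) < j := by exact_mod_cast hj
  rw [← inv_inj, interpExponent_inv, ← ENNReal.ofReal_inv_of_pos (by positivity), inv_div,
    ENNReal.ofReal_div_of_pos (by positivity), ENNReal.ofReal_natCast,
    ← ENNReal.ofReal_natCast (2 * m)]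
  push_cast
  rfl

theorem interpExponent_self {m : ℕ} (hm : 0 < m) : interpExponent m m = 2 := by
  rw [interpExponent_eq_ofReal hm hm, mul_div_assoc, div_self (by positivity)]
  simp

theorem holderTriple_interpExponent {m s t n : ℕ} (h : s + t = n) :
    ENNReal.HolderTriple (interpExponent m s) (interpExponent m t) (interpExponent m n) := by
  constructor
  simp only [interpExponent_inv]
  rw [← ENNReal.add_div, ← h]
  push_cast
  rfl

theorem eLpNorm_pdIter_le_derivNorm (m : ℕ) (L : List (Fin 3)) (u : Pt → ℝ) :
    eLpNorm (pdIter L u) (interpExponent m L.length) (volume.restrict cube)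
      ≤ derivNorm m L.length u := by
  have h := le_iSup (fun w : Fin L.length → Fin 3 =>
    eLpNorm (pdIter (List.ofFn w) u) (interpExponent m L.length) (volume.restrict cube)) L.get
  rw [List.ofFn_get] at h
  exact h

theorem derivNorm_ne_top (m j : ℕ) {u : Pt → ℝ} (hu : SmoothPeriodic u) :
    derivNorm m j u ≠ ⊤ := by
  have hsum := ENNReal.sum_lt_top.2 fun (w : Fin j → Fin 3) (_ : w ∈ Finset.univ) =>
    ((hu.pdIter (List.ofFn w)).eLpNorm_ne_top (interpExponent m j)).lt_top
  refine (lt_of_le_of_lt (iSup_le fun w => ?_) hsum).ne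
  exact Finset.single_le_sum (f := fun w : Fin j → Fin 3 =>
    eLpNorm (pdIter (List.ofFn w) u) (interpExponent m j) (volume.restrict cube))
    (fun _ _ => zero_le) (Finset.mem_univ w)

theorem derivNorm_sq_le {m j : ℕ} (hj : j + 2 ≤ m) {u : Pt → ℝ} (hu : SmoothPeriodic u) :
    derivNorm m (j + 1) u ^ 2 ≤ (2 * m : ℕ) * (derivNorm m j u * derivNorm m (j + 2) u) := by
  rw [derivNorm, ENNReal.iSup_pow_of_ne_zero two_ne_zero]
  refine iSup_le fun w => ?_
  rw [List.ofFn_succ]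
  set L := List.ofFn fun k : Fin j => w k.succ with hL
  have hlen : L.length = j := by simp [hL]
  have hm : (0 : ℝ) < m := by exact_mod_cast (by omega : 0 < m)
  have hjm : (j : ℝ) + 2 ≤ m := by exact_mod_cast hj
  set p : ℝ := 2 * m / (j + 1 : ℕ) with hp
  have hp2 : 2 < p := by
    rw [hp, lt_div_iff₀ (by positivity)]
    push_cast
    linarith
  have hpm : p - 1 ≤ 2 * m := by
    have : p ≤ 2 * m :=
      div_le_self (by positivity) (by exact_mod_cast Nat.succ_le_succ (Nat.zero_le j))
    linarith
  have hT : ENNReal.HolderTriple (interpExponent m j) (interpExponent m (j + 2))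
      (ENNReal.ofReal (p / 2)) := by
    have h2 : ENNReal.ofReal (p / 2) = interpExponent m (2 * (j + 1)) := by
      rw [interpExponent_eq_ofReal (by omega) (by omega), hp]
      congr 1
      push_cast
      field_simp
    rw [h2]
    exact holderTriple_interpExponent (by ring)
  have h := eLpNorm_pd_sq_le (hu.pdIter L) (w 0) hp2 (interpExponent m j)
    (interpExponent m (j + 2))
  rw [← interpExponent_eq_ofReal (by omega) (by omega)] at h
  refine h.trans ?_
  gcongr
  · rw [← ENNReal.ofReal_natCast]
    exact ENNReal.ofReal_le_ofReal (by push_cast; exact hpm)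
  · have := eLpNorm_pdIter_le_derivNorm m L u
    rwa [hlen] at this
  · have := eLpNorm_pdIter_le_derivNorm m (w 0 :: w 0 :: L) u
    rwa [show (w 0 :: w 0 :: L).length = j + 2 by simp [hlen]] at this

theorem derivNorm_mul_derivNorm_le {m s t : ℕ} (hm : 0 < m) (hst : s + t = m) {u w : Pt → ℝ}
    (hu : SmoothPeriodic u) (hw : SmoothPeriodic w) :
    derivNorm m s u * derivNorm m t w ≤ ((2 * m : ℕ) : ENNReal) ^ (m * m)
      * (derivNorm m 0 u * derivNorm m m w + derivNorm m m u * derivNorm m 0 w) := by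
  have htop : ∀ j k, derivNorm m j u * derivNorm m k w ≠ ⊤ := fun j k =>
    ENNReal.mul_ne_top (derivNorm_ne_top m j hu) (derivNorm_ne_top m k hw)
  have hK : (1 : ℝ) ≤ (2 * m : ℕ) := by exact_mod_cast (by omega : 1 ≤ 2 * m)
  have key := le_pow_mul_add_of_sq_le_mul (m := m) hK
    (c := fun j => (derivNorm m j u * derivNorm m (m - j) w).toReal)
    (fun _ => ENNReal.toReal_nonneg) (fun j hj => by
      obtain ⟨n, rfl⟩ := Nat.exists_eq_add_of_le hj
      have e1 : j + 2 + n - (j + 1) = n + 1 := by omega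
      have e2 : j + 2 + n - j = n + 2 := by omega
      have e3 : j + 2 + n - (j + 2) = n := by omega
      simp only [e1, e2, e3]
      rw [← ENNReal.toReal_pow, ← ENNReal.toReal_mul, ← ENNReal.toReal_natCast,
        ← ENNReal.toReal_pow, ← ENNReal.toReal_mul]
      refine ENNReal.toReal_mono (ENNReal.mul_ne_top (by finiteness)
        (ENNReal.mul_ne_top (htop _ _) (htop _ _))) ?_
      have h1 := derivNorm_sq_le (j := j) hj hu
      have h2 := derivNorm_sq_le (m := j + 2 + n) (j := n) (by omega) hw
      rw [mul_pow]
      refine (mul_le_mul' h1 h2).trans_eq ?_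
      ring) (j := s) (by omega)
  have e1 : m - s = t := by omega
  simp only [e1, Nat.sub_zero, Nat.sub_self] at key
  rw [← ENNReal.toReal_add (htop _ _) (htop _ _), ← ENNReal.toReal_natCast,
    ← ENNReal.toReal_pow, ← ENNReal.toReal_mul] at key
  exact (ENNReal.toReal_le_toReal (htop _ _) (ENNReal.mul_ne_top (by finiteness)
    (ENNReal.add_ne_top.2 ⟨htop _ _, htop _ _⟩))).1 key

theorem eLpNorm_pdIter_mul_le (L : List (Fin 3)) {f h : Pt → ℝ} (hf : SmoothPeriodic f)
    (hh : SmoothPeriodic h) {B p : ENNReal} (hp : 1 ≤ p)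
    (hB : ∀ S T : List (Fin 3), S.length + T.length = L.length →
      eLpNorm (fun x => pdIter S f x * pdIter T h x) p (volume.restrict cube) ≤ B) :
    eLpNorm (pdIter L fun x => f x * h x) p (volume.restrict cube) ≤ 2 ^ L.length * B := by
  induction L using List.reverseRecOn generalizing f h with
  | nil => simpa [pdIter] using hB [] [] rfl
  | append_singleton L i ih =>
    rw [pdIter_append_singleton, pd_mul hf.differentiable hh.differentiable,
      ((hf.pd i).mul hh).pdIter_add (hf.mul (hh.pd i))]
    have h1 := ih (hf.pd i) hh fun S T hST => by
      simpa only [pdIter_append_singleton] using hB (S ++ [i]) T (by simp; omega)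
    have h2 := ih hf (hh.pd i) fun S T hST => by
      simpa only [pdIter_append_singleton] using hB S (T ++ [i]) (by simp; omega)
    refine (eLpNorm_add_le (((hf.pd i).mul hh).pdIter L).continuous.aestronglyMeasurable
      ((hf.mul (hh.pd i)).pdIter L).continuous.aestronglyMeasurable hp).trans ?_
    refine (add_le_add h1 h2).trans_eq ?_
    simp only [List.length_append, List.length_singleton]
    ring

theorem eLpNorm_commutator_le (L : List (Fin 3)) {f h : Pt → ℝ} (hf : SmoothPeriodic f)
    (hh : SmoothPeriodic h) {B p : ENNReal} (hp : 1 ≤ p)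
    (hB : ∀ (S T : List (Fin 3)) (i : Fin 3), S.length + T.length + 1 = L.length →
      eLpNorm (fun x => pdIter S (pd i f) x * pdIter T h x) p (volume.restrict cube) ≤ B) :
    eLpNorm (fun x => pdIter L (fun y => f y * h y) x - f x * pdIter L h x) p
      (volume.restrict cube) ≤ 2 ^ L.length * B := by
  induction L using List.reverseRecOn generalizing h with
  | nil => simp [pdIter]
  | append_singleton L i ih =>
    simp only [pdIter_append_singleton]
    rw [pd_mul hf.differentiable hh.differentiable,
      ((hf.pd i).mul hh).pdIter_add (hf.mul (hh.pd i))]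
    have h1 := eLpNorm_pdIter_mul_le L (hf.pd i) hh hp fun S T hST => hB S T i (by simp; omega)
    have h2 := ih (hh.pd i) fun S T k hST => by
      simpa only [pdIter_append_singleton] using hB S (T ++ [i]) k (by simp; omega)
    have hc := ((hf.mul (hh.pd i)).pdIter L).continuous.sub
      (hf.continuous.mul ((hh.pd i).pdIter L).continuous)
    have h3 := eLpNorm_add_le (μ := volume.restrict cube)
      (((hf.pd i).mul hh).pdIter L).continuous.aestronglyMeasurable hc.aestronglyMeasurable hp
    simp only [add_sub_assoc]
    refine h3.trans ((add_le_add h1 h2).trans_eq ?_)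
    simp only [List.length_append, List.length_singleton]
    ring

theorem abs_pd_le_LinfGrad {f : Pt → ℝ} (hf : SmoothPeriodic f) (i : Fin 3)
    (x : Pt) : |pd i f x| ≤ LinfGrad f := by
  choose C hC using fun i => (hf.pd i).exists_bound
  have hbdd : BddAbove (range fun x => Real.sqrt (∑ i, (pd i f x) ^ 2)) := by
    refine ⟨Real.sqrt (∑ i, C i ^ 2), ?_⟩
    rintro _ ⟨x, rfl⟩
    exact Real.sqrt_le_sqrt (Finset.sum_le_sum fun i _ => sq_le_sq' (abs_le.1 (hC i x)).1
      (abs_le.1 (hC i x)).2)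
  refine le_trans ?_ (le_ciSup hbdd x)
  exact Real.abs_le_sqrt (Finset.single_le_sum (f := fun i => (pd i f x) ^ 2)
    (fun _ _ => sq_nonneg _) (Finset.mem_univ i))

theorem LinfGrad_nonneg (f : Pt → ℝ) : 0 ≤ LinfGrad f :=
  Real.iSup_nonneg fun _ => Real.sqrt_nonneg _

theorem HSobGrad_nonneg (m : ℕ) (f : Pt → ℝ) : 0 ≤ HSobGrad m f :=
  Real.sqrt_nonneg _

theorem eLpNorm_two_eq_ofReal_L2norm {f : Pt → ℝ} (hf : Continuous f) :
    eLpNorm f 2 (volume.restrict cube) = ENNReal.ofReal (L2norm f) := by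
  rw [eLpNorm_eq_lintegral_rpow_enorm_toReal two_ne_zero ENNReal.ofNat_ne_top, L2norm,
    Real.sqrt_eq_rpow, ← ENNReal.ofReal_rpow_of_nonneg (integral_nonneg fun x => sq_nonneg _)
      (by norm_num), ofReal_integral_eq_lintegral_ofReal
      (Continuous.integrable_cube (F := fun x => f x ^ 2) (hf.pow 2))
      (Filter.Eventually.of_forall fun x => sq_nonneg _)]
  congr 1
  refine lintegral_congr fun x => ?_
  rw [← ofReal_norm, ENNReal.toReal_ofNat, ENNReal.ofReal_rpow_of_nonneg (norm_nonneg _) (by simp)]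
  simp

theorem derivNorm_zero_pd_le {f : Pt → ℝ} (hf : SmoothPeriodic f) (m : ℕ) (i : Fin 3) :
    derivNorm m 0 (pd i f) ≤ ENNReal.ofReal (LinfGrad f) := by
  refine iSup_le fun w => ?_
  have h : interpExponent m 0 = ⊤ := by simp [interpExponent]
  rw [h, eLpNorm_exponent_top]
  exact eLpNormEssSup_le_of_ae_bound
    (Filter.Eventually.of_forall fun x => abs_pd_le_LinfGrad hf i x)

theorem derivNorm_self_pd_le {g : Pt → ℝ} (hg : SmoothPeriodic g) {m : ℕ} (hm : 0 < m)
    (a : Fin 3) : derivNorm m m (pd a g) ≤ ENNReal.ofReal (HSobGrad m g) := by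
  refine iSup_le fun w => ?_
  rw [interpExponent_self hm, eLpNorm_two_eq_ofReal_L2norm ((hg.pd a).pdIter _).continuous]
  refine ENNReal.ofReal_le_ofReal (Real.sqrt_le_sqrt ?_)
  have hnn : ∀ k, 0 ≤ HdotSq k g := fun k =>
    integral_nonneg fun x => Finset.sum_nonneg fun _ _ => sq_nonneg _
  refine le_trans ?_ (Finset.single_le_sum (f := fun k => HdotSq (k + 1) g)
    (fun k _ => hnn _) (Finset.mem_range.2 (Nat.lt_succ_self m)))
  have hlist : List.ofFn (Fin.snoc w a : Fin (m + 1) → Fin 3) = List.ofFn w ++ [a] := by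
    rw [List.ofFn_succ_last]
    simp
  refine integral_mono (((hg.pd a).pdIter _).continuous.pow 2).integrable_cube
    (continuous_finsetSum _ fun js _ => (hg.pdIter _).continuous.pow 2).integrable_cube
    fun x => ?_
  have := Finset.single_le_sum (f := fun js : Fin (m + 1) → Fin 3 =>
    (pdIter (List.ofFn js) g x) ^ 2) (fun _ _ => sq_nonneg _)
    (Finset.mem_univ (Fin.snoc w a : Fin (m + 1) → Fin 3))
  simpa only [hlist, pdIter_append_singleton] using this

/-- Moser commutator estimate: for an integer `ℓ > 1` and a multi-index
`β` with `|β| = ℓ`, there is `C > 0` such that for all `f, g ∈ H^ℓ(T³) ∩ W^{1,∞}(T³)`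
and each direction `a`,
`‖∂^β(f ∂_a g) − f ∂_a ∂^β g‖_{L²} ≤ C(‖∂f‖_{L^∞}‖∂g‖_{H^{ℓ−1}} + ‖∂g‖_{L^∞}‖∂f‖_{H^{ℓ−1}})`. -/
theorem statement5 (ℓ : ℕ) (hℓ : 1 < ℓ) (β : Fin ℓ → Fin 3) :
    ∃ C > 0, ∀ (f g : Pt → ℝ),
      ContDiff ℝ (⊤ : ℕ∞) f → ContDiff ℝ (⊤ : ℕ∞) g → Periodic3 f → Periodic3 g →
      ∀ a : Fin 3,
        L2norm (fun x => pdIter (List.ofFn β) (fun y => f y * pd a g y) x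
            - f x * pd a (pdIter (List.ofFn β) g) x)
          ≤ C * (LinfGrad f * HSobGrad (ℓ-1) g + LinfGrad g * HSobGrad (ℓ-1) f) := by
  obtain ⟨m, rfl⟩ : ∃ m, ℓ = m + 1 := ⟨ℓ - 1, by omega⟩
  have hm : 0 < m := by omega
  refine ⟨2 ^ (m + 1) * (2 * m : ℕ) ^ (m * m), by positivity, fun f g hf hg hfp hgp a => ?_⟩
  have hF : SmoothPeriodic f := ⟨hf, hfp⟩
  have hG : SmoothPeriodic g := ⟨hg, hgp⟩
  rw [Nat.add_sub_cancel, pd_pdIter hG]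
  have hnn : 0 ≤ LinfGrad f * HSobGrad m g + LinfGrad g * HSobGrad m f :=
    add_nonneg (mul_nonneg (LinfGrad_nonneg f) (HSobGrad_nonneg m _))
      (mul_nonneg (LinfGrad_nonneg g) (HSobGrad_nonneg m _))
  rw [← ENNReal.ofReal_le_ofReal_iff (by positivity)]
  have hcont : Continuous fun x => pdIter (List.ofFn β) (fun y => f y * pd a g y) x
      - f x * pdIter (List.ofFn β) (pd a g) x :=
    ((hF.mul (hG.pd a)).pdIter (List.ofFn β)).continuous.sub
    (hF.continuous.mul ((hG.pd a).pdIter (List.ofFn β)).continuous)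
  have hbound := eLpNorm_commutator_le (List.ofFn β) hF (hG.pd a) (p := 2) (by norm_num)
    (B := ((2 * m : ℕ) : ENNReal) ^ (m * m)
      * ENNReal.ofReal (LinfGrad f * HSobGrad m g + LinfGrad g * HSobGrad m f))
    (fun S T i hST => by
      have hlen : S.length + T.length = m := by simpa using hST
      have hT := holderTriple_interpExponent (m := m) hlen
      rw [interpExponent_self hm] at hT
      refine (eLpNorm_mul_le_of_holderTriple ((hF.pd i).pdIter S).continuous
        ((hG.pd a).pdIter T).continuous (interpExponent m S.length)
        (interpExponent m T.length) 2).trans ?_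
      refine (mul_le_mul' (eLpNorm_pdIter_le_derivNorm m S _)
        (eLpNorm_pdIter_le_derivNorm m T _)).trans ?_
      refine (derivNorm_mul_derivNorm_le hm hlen (hF.pd i) (hG.pd a)).trans ?_
      rw [ENNReal.ofReal_add (mul_nonneg (LinfGrad_nonneg f) (HSobGrad_nonneg m g))
        (mul_nonneg (LinfGrad_nonneg g) (HSobGrad_nonneg m f)),
        ENNReal.ofReal_mul (LinfGrad_nonneg f), ENNReal.ofReal_mul (LinfGrad_nonneg g),
        mul_comm (derivNorm m m _)]
      gcongr
      · exact derivNorm_zero_pd_le hF m i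
      · exact derivNorm_self_pd_le hG hm a
      · exact derivNorm_zero_pd_le hG m a
      · exact derivNorm_self_pd_le hF hm i)
  rw [eLpNorm_two_eq_ofReal_L2norm hcont, List.length_ofFn] at hbound
  refine hbound.trans_eq ?_
  rw [ENNReal.ofReal_mul (by positivity), ENNReal.ofReal_mul (by positivity),
    ENNReal.ofReal_pow (by positivity), ENNReal.ofReal_pow (by positivity),
    ENNReal.ofReal_natCast, ENNReal.ofReal_ofNat, mul_assoc]
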